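/- For each θ ∈ 𝔽₄ with θ² + θ + 1 = 0, the cubic surface S₃(θ) has exactly 225 points over 𝔽₁₆: the number of points [v] of ℙ³(𝔽₁₆) with f₃(v) = 0 equals 225 (equivalently, the number of nonzero vectors v ∈ 𝔽₁₆⁴ with f₃(v) = 0 equals 3375). -/

import Mathlib

open MvPolynomial

/-- The cubic form `X³ + Y³ + Z³ + θW³` with the variables `X, Y, Z, W` indexed by
`0, 1, 2, 3`, over any commutative ring `K` containing the coefficient `θ`. -/
noncomputable def f₃ (K : Type*) [CommRing K] (θ : K) : MvPolynomial (Fin 4) K :=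
  X 0 ^ 3 + X 1 ^ 3 + X 2 ^ 3 + C θ * X 3 ^ 3

/-- The number of nonzero vectors in a cone over a finite field is the number of points of its
projectivization times the number of units of the field. -/
theorem Projectivization.ncard_cone_eq_mul {K V : Type*} [Field K] [AddCommGroup V] [Module K V]
    (P : V → Prop) (hP : ∀ (a : Kˣ) (v : V), P (a • v) ↔ P v) :
    {v : V | v ≠ 0 ∧ P v}.ncard = {x : Projectivization K V | P x.rep}.ncard * Nat.card Kˣ := by
  rw [← Nat.card_coe_set_eq, ← Nat.card_coe_set_eq, ← Nat.card_prod]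
  symm
  refine Nat.card_eq_of_bijective
    (fun p : {x : Projectivization K V | P x.rep} × Kˣ ↦
      (⟨p.2 • p.1.1.rep, (smul_ne_zero_iff_ne p.2).2 p.1.1.rep_nonzero, (hP _ _).2 p.1.2⟩ :
        {v : V | v ≠ 0 ∧ P v})) ⟨?_, ?_⟩
  · rintro ⟨⟨x, hx⟩, a⟩ ⟨⟨y, hy⟩, b⟩ h
    have h' : a • x.rep = b • y.rep := congrArg Subtype.val h
    obtain rfl : x = y := by
      rw [← x.mk_rep, ← y.mk_rep, Projectivization.mk_eq_mk_iff]
      exact ⟨a⁻¹ * b, by rw [mul_smul, ← h', inv_smul_smul]⟩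
    have hab : a = b := Units.ext (smul_left_injective K x.rep_nonzero h')
    rw [hab]
  · rintro ⟨v, hv, hPv⟩
    obtain ⟨a, ha⟩ := Projectivization.exists_smul_eq_mk_rep K v hv
    refine ⟨⟨⟨Projectivization.mk K v hv, ?_⟩, a⁻¹⟩, Subtype.ext ?_⟩
    · rw [Set.mem_ofPred_eq, ← ha, hP]
      exact hPv
    · simp [← ha]

theorem eval_f₃ {K : Type*} [CommRing K] (θ : K) (v : Fin 4 → K) :
    eval v (f₃ K θ) = v 0 ^ 3 + v 1 ^ 3 + v 2 ^ 3 + θ * v 3 ^ 3 := by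
  simp [f₃]

theorem eval_smul_f₃ {K : Type*} [CommRing K] (θ a : K) (v : Fin 4 → K) :
    eval (a • v) (f₃ K θ) = a ^ 3 * eval v (f₃ K θ) := by
  simp only [eval_f₃, Pi.smul_apply, smul_eq_mul]
  ring

/-- Counting the zeros of `f₃` by the coordinates other than the third. -/
theorem ncard_zeros_f₃_eq_sum {K : Type*} [CommRing K] [Fintype K] [DecidableEq K] (θ : K) :
    {v : Fin 4 → K | eval v (f₃ K θ) = 0}.ncard =
      ∑ x : K, ∑ y : K, ∑ w : K,
        (Finset.univ.filter fun z : K ↦ z ^ 3 = -(x ^ 3 + y ^ 3 + θ * w ^ 3)).card := by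
  simp only [← Finset.card_sigma]
  rw [← Set.ncard_coe_finset]
  refine Set.ncard_congr (fun v _ ↦ ⟨v 0, v 1, v 3, v 2⟩) ?_ ?_ ?_
  · intro v hv
    rw [Set.mem_ofPred_eq, eval_f₃] at hv
    simp only [Finset.mem_coe, Finset.mem_sigma, Finset.mem_filter, Finset.mem_univ, true_and]
    linear_combination hv
  · intro v u _ _ h
    simp only [Sigma.mk.injEq, heq_eq_eq] at h
    ext i
    fin_cases i
    exacts [h.1, h.2.1, h.2.2.2, h.2.2.1]
  · rintro ⟨x, y, w, z⟩ h
    simp only [Finset.mem_coe, Finset.mem_sigma, Finset.mem_filter, Finset.mem_univ,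
      true_and] at h
    refine ⟨![x, y, z, w], ?_, rfl⟩
    rw [Set.mem_ofPred_eq, eval_f₃]
    change x ^ 3 + y ^ 3 + z ^ 3 + θ * w ^ 3 = 0
    linear_combination h

theorem ncard_zeros_f₃_congr {K L : Type*} [CommRing K] [CommRing L] (e : K ≃+* L) (θ : K) :
    {v : Fin 4 → K | eval v (f₃ K θ) = 0}.ncard =
      {v : Fin 4 → L | eval v (f₃ L (e θ)) = 0}.ncard := by
  rw [← Nat.card_coe_set_eq, ← Nat.card_coe_set_eq]
  refine Nat.card_congr ((Equiv.piCongrRight fun _ ↦ e.toEquiv).subtypeEquiv fun v ↦ ?_)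
  rw [Set.mem_ofPred_eq, Set.mem_ofPred_eq, eval_f₃, eval_f₃, ← e.map_eq_zero_iff]
  simp

instance QuadraticAlgebra.instFintype {R : Type*} [Fintype R] (a b : R) :
    Fintype (QuadraticAlgebra R a b) :=
  Fintype.ofEquiv (R × R) (QuadraticAlgebra.equivProd a b).symm

/-- A computable model of `𝔽₄`, generated over `𝔽₂` by a root `ω` of `ω² = 1 + ω`. -/
abbrev F4Model : Type := QuadraticAlgebra (ZMod 2) 1 1

instance : Fact (∀ r : ZMod 2, r ^ 2 ≠ 1 + 1 * r) := ⟨by decide⟩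

/-- A computable model of `𝔽₁₆`, generated over `𝔽₄` by a root `η` of `η² = ω + η`. -/
abbrev F16Model : Type := QuadraticAlgebra F4Model ⟨0, 1⟩ 1

instance : Fact (∀ r : F4Model, r ^ 2 ≠ ⟨0, 1⟩ + 1 * r) := ⟨by decide +kernel⟩

theorem F16Model.card : Fintype.card F16Model = 16 := by decide +kernel

theorem F16Model.card_cube_roots (c : F16Model) :
    (Finset.univ.filter fun x : F16Model ↦ x ^ 3 = c).card =
      if c = 0 then 1 else if c ^ 5 = 1 then 3 else 0 := by
  revert c
  decide +kernel

/-- Cubing is three-to-one from the nonzero elements onto the fifth roots of unity. -/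
theorem F16Model.sum_comp_cube (g : F16Model → ℕ) :
    ∑ x, g (x ^ 3) = g 0 + 3 * ∑ c with c ^ 5 = 1, g c := by
  rw [← Finset.sum_fiberwise' Finset.univ (fun x : F16Model ↦ x ^ 3) g]
  simp only [Finset.sum_const, F16Model.card_cube_roots, smul_eq_mul]
  rw [← Finset.add_sum_erase _ _ (Finset.mem_univ 0), Finset.sum_filter, Finset.mul_sum,
    ← Finset.add_sum_erase Finset.univ (fun c ↦ 3 * _) (Finset.mem_univ 0)]
  simp only [if_true, one_mul, ne_eq, OfNat.ofNat_ne_zero, not_false_eq_true, zero_pow,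
    zero_ne_one, if_false, mul_zero, zero_add]
  refine congrArg _ (Finset.sum_congr rfl fun c hc ↦ ?_)
  rw [if_neg (Finset.ne_of_mem_erase hc)]
  split_ifs <;> simp

theorem F16Model.ncard_zeros_f₃ (θ : F16Model) (hθ : θ ^ 2 + θ + 1 = 0) :
    {v : Fin 4 → F16Model | eval v (f₃ F16Model θ) = 0}.ncard = 3376 := by
  rw [ncard_zeros_f₃_eq_sum, F16Model.sum_comp_cube fun a ↦ ∑ y : F16Model, ∑ w : F16Model,
    (Finset.univ.filter fun z : F16Model ↦ z ^ 3 = -(a + y ^ 3 + θ * w ^ 3)).card]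
  simp only [fun a ↦ F16Model.sum_comp_cube fun b ↦ ∑ w : F16Model,
    (Finset.univ.filter fun z : F16Model ↦ z ^ 3 = -(a + b + θ * w ^ 3)).card]
  simp only [fun a b ↦ F16Model.sum_comp_cube fun d ↦
    (Finset.univ.filter fun z : F16Model ↦ z ^ 3 = -(a + b + θ * d)).card]
  revert θ
  decide +kernel

theorem ncard_zeros_f₃_of_card_eq_sixteen {K : Type*} [Field K] (hK : Nat.card K = 16) (θ : K)
    (hθ : θ ^ 2 + θ + 1 = 0) : {v : Fin 4 → K | eval v (f₃ K θ) = 0}.ncard = 3376 := by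
  have : Finite K := Nat.finite_of_card_ne_zero (by simp [hK])
  have := Fintype.ofFinite K
  let e : K ≃+* F16Model := FiniteField.ringEquivOfCardEq <| by
    rw [F16Model.card, Fintype.card_eq_nat_card, hK]
  rw [ncard_zeros_f₃_congr e]
  exact F16Model.ncard_zeros_f₃ (e θ) (by simpa using congrArg e hθ)

/-- For each `θ ∈ 𝔽₄` with `θ² + θ + 1 = 0`, the cubic surface `S₃(θ)` has exactly `225`
points over `𝔽₁₆` (equivalently, `3375` nonzero vectors of `𝔽₁₆⁴` lie on the affine cone),
where the coefficients are viewed in `𝔽₁₆` via an embedding `𝔽₄ → 𝔽₁₆`. -/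
theorem S₃_card_points_over_F16 (θ : GaloisField 2 2) (hθ : θ ^ 2 + θ + 1 = 0)
    (ι : GaloisField 2 2 →+* GaloisField 2 4) :
    {x : Projectivization (GaloisField 2 4) (Fin 4 → GaloisField 2 4) |
        eval x.rep (f₃ (GaloisField 2 4) (ι θ)) = 0}.ncard = 225
      ∧ {v : Fin 4 → GaloisField 2 4 | v ≠ 0 ∧ eval v (f₃ (GaloisField 2 4) (ι θ)) = 0}.ncard
          = 3375 := by
  have hK : Nat.card (GaloisField 2 4) = 16 := GaloisField.card 2 4 (by norm_num)
  have : Finite (GaloisField 2 4) := Nat.finite_of_card_ne_zero (by simp [hK])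
  have hcone : {v : Fin 4 → GaloisField 2 4 |
      v ≠ 0 ∧ eval v (f₃ (GaloisField 2 4) (ι θ)) = 0}.ncard = 3375 := by
    have hzero : (0 : Fin 4 → GaloisField 2 4) ∈
        {v | eval v (f₃ (GaloisField 2 4) (ι θ)) = 0} := by
      simp [eval_f₃]
    have hdiff := Set.ncard_sdiff_singleton_of_mem hzero
    rw [ncard_zeros_f₃_of_card_eq_sixteen hK (ι θ) (by simpa using congrArg ι hθ)] at hdiff
    refine Eq.trans (congrArg Set.ncard ?_) hdiff
    ext v
    simp [and_comm]
  refine ⟨?_, hcone⟩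
  have hmul := Projectivization.ncard_cone_eq_mul (K := GaloisField 2 4)
    (fun v : Fin 4 → GaloisField 2 4 ↦ eval v (f₃ (GaloisField 2 4) (ι θ)) = 0) fun a v ↦ by
      rw [Units.smul_def, eval_smul_f₃]
      simp
  rw [hcone, Nat.card_units, hK] at hmul
  lia
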